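/- Let σ be a distortion function and p ∈ [1,∞). For every Z in the Köthe dual L_σ^p(P)^×, one has sup{|E(ZY)| : Y ∈ L_σ^p(P), ‖Y‖_{σ,p} ≤ 1} < ∞; the map φ_Z : L_σ^p(P) → 𝕂, φ_Z(Y) = E(ZY), is a continuous linear functional; and Φ : L_σ^p(P)^× → L_σ^p(P)*, Z ↦ φ_Z, is a linear bijection onto the continuous dual of L_σ^p(P) with operator norm ‖Φ(Z)‖ = sup{|E(ZY)| : ‖Y‖_{σ,p} ≤ 1} for every Z ∈ L_σ^p(P)^×. -/

import Mathlib

open MeasureTheory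
open scoped ENNReal NNReal

noncomputable section

variable {Ω : Type*} [MeasurableSpace Ω]

/-- A `[0,1]`-valued random variable uniformly distributed on `[0,1]`:
`P(U ≤ u) = u` for all `u ∈ [0,1]`. -/
def IsUniformRV (P : Measure Ω) (U : Ω → ℝ) : Prop :=
  Measurable U ∧ (∀ ω, U ω ∈ Set.Icc (0 : ℝ) 1) ∧
    ∀ u ∈ Set.Icc (0 : ℝ) 1, P {ω | U ω ≤ u} = ENNReal.ofReal u

/-- A distortion function: nondecreasing, nonnegative, left-continuous on `[0,1)`
with `∫₀¹ σ(u) du = 1`. -/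
structure IsDistortion (σ : ℝ → ℝ) : Prop where
  nonneg : ∀ u ∈ Set.Ico (0 : ℝ) 1, 0 ≤ σ u
  mono : MonotoneOn σ (Set.Ico (0 : ℝ) 1)
  left_continuous : ∀ u ∈ Set.Ioo (0 : ℝ) 1,
    Filter.Tendsto σ (nhdsWithin u (Set.Iio u)) (nhds (σ u))
  integral_one : ∫ u in Set.Ioo (0 : ℝ) 1, σ u = 1

/-- `‖Y‖_{σ,p}^p := sup over uniform U of E[σ(U)·‖Y‖^p]`. -/
def sigmaPow (P : Measure Ω) (σ : ℝ → ℝ) (p : ℝ) {X : Type*} [NormedAddCommGroup X]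
    (Y : Ω → X) : ℝ≥0∞ :=
  ⨆ (U : Ω → ℝ) (_ : IsUniformRV P U),
    ∫⁻ ω, ENNReal.ofReal (σ (U ω)) * (‖Y ω‖₊ : ℝ≥0∞) ^ p ∂P

/-- The norm `‖Y‖_{σ,p}`. -/
def sigmaNorm (P : Measure Ω) (σ : ℝ → ℝ) (p : ℝ) {X : Type*} [NormedAddCommGroup X]
    (Y : Ω → X) : ℝ≥0∞ :=
  sigmaPow P σ p Y ^ (1 / p)

/-- Membership in `L_σ^p(P,X)`: strongly measurable with finite `σ,p`-norm. -/
def MemLsigma (P : Measure Ω) (σ : ℝ → ℝ) (p : ℝ) {X : Type*} [NormedAddCommGroup X]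
    (Y : Ω → X) : Prop :=
  AEStronglyMeasurable Y P ∧ sigmaPow P σ p Y < ∞

/-- The generalized inverse distribution function (quantile function)
`F_g^{-1}(α) = inf {q : P(g ≤ q) ≥ α}`. -/
def quantileFn (P : Measure Ω) (g : Ω → ℝ) (α : ℝ) : ℝ :=
  sInf {q : ℝ | ENNReal.ofReal α ≤ P {ω | g ω ≤ q}}

variable {𝕂 : Type*} [RCLike 𝕂]

/-- The Köthe dual of `L_σ^p(P)`:
`{Z measurable : Z·Y ∈ L¹(P) for all Y ∈ L_σ^p(P)}`. -/
def KoetheDual (P : Measure Ω) (σ : ℝ → ℝ) (p : ℝ) (Z : Ω → 𝕂) : Prop :=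
  AEStronglyMeasurable Z P ∧
    ∀ Y : Ω → 𝕂, MemLsigma P σ p Y → Integrable (fun ω => Z ω * Y ω) P

/-- The average value-at-risk of level `α` of the (nonnegative) random variable `g`:
`AV@R_α(g) = (1/(1−α)) ∫_α^1 F_g^{-1}(u) du`. -/
def avar (P : Measure Ω) (g : Ω → ℝ) (α : ℝ) : ℝ≥0∞ :=
  ENNReal.ofReal (1 / (1 - α)) *
    ∫⁻ u in Set.Ioo α 1, ENNReal.ofReal (quantileFn P g u)

/-- `Z'` σ-dominates `Z`: there is a uniform `U` with
`AV@R_α(σ(U)·|Z'|) ≥ AV@R_α(|Z|)` for all `α < 1`. -/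
def SigmaDominates (P : Measure Ω) (σ : ℝ → ℝ) (Z' Z : Ω → 𝕂) : Prop :=
  ∃ U : Ω → ℝ, IsUniformRV P U ∧ ∀ α ∈ Set.Ico (0 : ℝ) 1,
    avar P (fun ω => ‖Z ω‖) α ≤ avar P (fun ω => σ (U ω) * ‖Z' ω‖) α

/-- `|Z|*_{σ,∞} = sup_{α ∈ [0,1)} AV@R_α(|Z|) / ((1/(1−α))·S_σ(α))
 = sup_{α ∈ [0,1)} (∫_α^1 F_{|Z|}^{-1}(u) du) / (∫_α^1 σ(u) du)`. -/
def dualNormInf (P : Measure Ω) (σ : ℝ → ℝ) (Z : Ω → 𝕂) : ℝ≥0∞ :=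
  ⨆ (α : ℝ) (_ : α ∈ Set.Ico (0 : ℝ) 1),
    (∫⁻ u in Set.Ioo α 1, ENNReal.ofReal (quantileFn P (fun ω => ‖Z ω‖) u)) /
      ENNReal.ofReal (∫ u in Set.Ioo α 1, σ u)

/-- `|Z|*_{σ,q} = inf {‖Z'‖_{σ,q} : Z' σ-dominates Z}` (with `inf ∅ = ∞`). -/
def dualNormQ (P : Measure Ω) (σ : ℝ → ℝ) (q : ℝ) (Z : Ω → 𝕂) : ℝ≥0∞ :=
  ⨅ (Z' : Ω → 𝕂) (_ : AEStronglyMeasurable Z' P ∧ SigmaDominates P σ Z' Z),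
    sigmaNorm P σ q Z'

/-! ### Uniform random variables and their rearrangements -/

/-- `u ↦ P(B ∩ {U ≤ u})`. -/
def partialCdf (P : Measure Ω) (B : Set Ω) (U : Ω → ℝ) (u : ℝ) : ℝ :=
  P.real (B ∩ {ω | U ω ≤ u})

section Uniform

variable {P : Measure Ω} {U V : Ω → ℝ} {A B : Set Ω}

lemma IsUniformRV.measureReal_le (hU : IsUniformRV P U) {u : ℝ} (hu : u ∈ Set.Icc (0 : ℝ) 1) :
    P.real {ω | U ω ≤ u} = u := by
  rw [measureReal_def, hU.2.2 u hu, ENNReal.toReal_ofReal hu.1]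

lemma IsUniformRV.measurableSet_le (hU : IsUniformRV P U) (u : ℝ) :
    MeasurableSet {ω | U ω ≤ u} := _root_.measurableSet_le hU.1 measurable_const

lemma IsUniformRV.ae_pos (hU : IsUniformRV P U) : ∀ᵐ ω ∂P, 0 < U ω := by
  have h := hU.2.2 0 ⟨le_rfl, zero_le_one⟩
  rw [ENNReal.ofReal_zero] at h
  rw [ae_iff]
  simpa using h

lemma partialCdf_nonneg (u : ℝ) : 0 ≤ partialCdf P B U u := measureReal_nonneg

lemma partialCdf_one (hU : IsUniformRV P U) : partialCdf P B U 1 = P.real B := by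
  have : B ∩ {ω | U ω ≤ 1} = B := Set.inter_eq_left.2 fun ω _ => (hU.2.1 ω).2
  rw [partialCdf, this]

open Classical in
/-- The rearrangement taking the top levels on `A` in the order given by `V`, and the bottom
levels on `Aᶜ` in the order given by `U`. -/
def glueRV (P : Measure Ω) (A : Set Ω) (U V : Ω → ℝ) (ω : Ω) : ℝ :=
  if ω ∈ A then 1 - P.real A + partialCdf P A V (V ω) else partialCdf P Aᶜ U (U ω)

lemma glueRV_of_mem {ω : Ω} (h : ω ∈ A) :
    glueRV P A U V ω = 1 - P.real A + partialCdf P A V (V ω) := if_pos h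

lemma glueRV_of_notMem {ω : Ω} (h : ω ∉ A) : glueRV P A U V ω = partialCdf P Aᶜ U (U ω) :=
  if_neg h

lemma one_sub_le_glueRV {ω : Ω} (h : ω ∈ A) : 1 - P.real A ≤ glueRV P A U V ω := by
  rw [glueRV_of_mem h]
  linarith [partialCdf_nonneg (P := P) (B := A) (U := V) (V ω)]

variable [IsProbabilityMeasure P]

lemma IsUniformRV.ae_lt_one (hU : IsUniformRV P U) : ∀ᵐ ω ∂P, U ω < 1 := by
  have key : ∀ ε : ℝ, 0 < ε → ε ≤ 1 → P.real {ω | U ω < 1}ᶜ ≤ ε := by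
    intro ε h0 h1
    have h := hU.measureReal_le (u := 1 - ε) ⟨by linarith, by linarith⟩
    have h2 : P.real {ω | U ω ≤ 1 - ε}ᶜ = ε := by
      rw [probReal_compl_eq_one_sub (hU.measurableSet_le _), h]; ring
    rw [← h2]
    refine measureReal_mono ?_
    intro ω hω
    simp only [Set.mem_compl_iff, Set.mem_ofPred_eq, not_lt, not_le] at hω ⊢
    linarith
  have h0 : P.real {ω | U ω < 1}ᶜ ≤ 0 := by
    refine le_of_forall_pos_le_add fun ε hε => ?_
    rw [zero_add]
    exact (key (min ε 1) (by positivity) (min_le_right _ _)).trans (min_le_left _ _)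
  have h1 : P.real {ω | U ω < 1}ᶜ = 0 := le_antisymm h0 measureReal_nonneg
  exact (measureReal_eq_zero_iff).1 h1

lemma partialCdf_mono : Monotone (partialCdf P B U) := fun _ _ h =>
  measureReal_mono (Set.inter_subset_inter_right _ fun _ hω => le_trans hω h)

lemma partialCdf_le (u : ℝ) : partialCdf P B U u ≤ P.real B :=
  measureReal_mono Set.inter_subset_left

lemma partialCdf_le_self (hU : IsUniformRV P U) {u : ℝ} (hu : u ∈ Set.Icc (0 : ℝ) 1) :
    partialCdf P B U u ≤ u :=
  (measureReal_mono Set.inter_subset_right).trans_eq (hU.measureReal_le hu)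

lemma partialCdf_zero (hU : IsUniformRV P U) : partialCdf P B U 0 = 0 :=
  le_antisymm (partialCdf_le_self hU ⟨le_rfl, zero_le_one⟩) (partialCdf_nonneg 0)

lemma partialCdf_add_compl (hU : IsUniformRV P U) (hB : MeasurableSet B) {u : ℝ}
    (hu : u ∈ Set.Icc (0 : ℝ) 1) :
    partialCdf P B U u + partialCdf P Bᶜ U u = u := by
  rw [partialCdf, partialCdf, Set.inter_comm B, Set.inter_comm Bᶜ, ← Set.sdiff_eq,
    measureReal_inter_add_sdiff hB, hU.measureReal_le hu]

lemma partialCdf_sub_le (hU : IsUniformRV P U) (hB : MeasurableSet B) {u v : ℝ}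
    (hu : u ∈ Set.Icc (0 : ℝ) 1) (hv : v ∈ Set.Icc (0 : ℝ) 1) (huv : u ≤ v) :
    partialCdf P B U v - partialCdf P B U u ≤ v - u := by
  have h1 := partialCdf_add_compl hU hB hu
  have h2 := partialCdf_add_compl hU hB hv
  have h3 := partialCdf_mono (P := P) (B := Bᶜ) (U := U) huv
  linarith

lemma continuousOn_partialCdf (hU : IsUniformRV P U) (hB : MeasurableSet B) :
    ContinuousOn (partialCdf P B U) (Set.Icc 0 1) := by
  have : LipschitzOnWith 1 (partialCdf P B U) (Set.Icc 0 1) := by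
    refine LipschitzOnWith.of_le_add_mul 1 fun x hx y hy => ?_
    rw [NNReal.coe_one, one_mul, Real.dist_eq]
    rcases le_total x y with h | h
    · have := partialCdf_mono (P := P) (B := B) (U := U) h
      have := abs_nonneg (x - y)
      linarith
    · have := partialCdf_sub_le hU hB hy hx h
      have := le_abs_self (x - y)
      linarith
  exact this.continuousOn

/-- The probability integral transform on the event `B`. -/
lemma measureReal_partialCdf_le (hU : IsUniformRV P U) (hB : MeasurableSet B) {w : ℝ}
    (h0 : 0 ≤ w) (hw : w ≤ P.real B) :
    P.real (B ∩ {ω | partialCdf P B U (U ω) ≤ w}) = w := by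
  have hc := continuousOn_partialCdf hU hB
  obtain ⟨m, ⟨hm, hmw⟩, hmax⟩ : ∃ m, IsGreatest
      (Set.Icc 0 1 ∩ partialCdf P B U ⁻¹' Set.Iic w) m := by
    refine IsCompact.exists_isGreatest ?_ ⟨0, ⟨le_rfl, zero_le_one⟩, ?_⟩
    · exact isCompact_Icc.of_isClosed_subset (hc.preimage_isClosed_of_isClosed isClosed_Icc
        isClosed_Iic) Set.inter_subset_left
    · simpa [partialCdf_zero hU] using h0
  have hset : {ω | partialCdf P B U (U ω) ≤ w} = {ω | U ω ≤ m} := by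
    ext ω
    exact ⟨fun h => hmax ⟨hU.2.1 ω, h⟩, fun h => (partialCdf_mono h).trans hmw⟩
  obtain ⟨v, hv, hvw⟩ : w ∈ partialCdf P B U '' Set.Icc 0 1 := by
    refine intermediate_value_Icc zero_le_one hc ?_
    rw [partialCdf_zero hU, partialCdf_one hU]
    exact ⟨h0, hw⟩
  rw [hset]
  refine le_antisymm hmw ?_
  have hvm : v ≤ m := hmax ⟨hv, hvw.le⟩
  exact hvw.symm.le.trans (partialCdf_mono hvm)

lemma isUniformRV_glueRV (hA : MeasurableSet A) (hU : IsUniformRV P U) (hV : IsUniformRV P V) :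
    IsUniformRV P (glueRV P A U V) := by
  have hcompl : P.real Aᶜ = 1 - P.real A := probReal_compl_eq_one_sub hA
  have hA1 : P.real A ≤ 1 := measureReal_le_one
  have hA0 : 0 ≤ P.real A := measureReal_nonneg
  have hmeas : Measurable (glueRV P A U V) := by
    classical
    refine Measurable.ite hA ?_ ?_
    · exact measurable_const.add (partialCdf_mono.measurable.comp hV.1)
    · exact partialCdf_mono.measurable.comp hU.1
  refine ⟨hmeas, fun ω => ?_, fun w hw => ?_⟩
  · by_cases h : ω ∈ A
    · rw [glueRV_of_mem h]
      have h1 := partialCdf_nonneg (P := P) (B := A) (U := V) (V ω)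
      have h2 := partialCdf_le (P := P) (B := A) (U := V) (V ω)
      constructor <;> linarith
    · rw [glueRV_of_notMem h]
      have h1 := partialCdf_nonneg (P := P) (B := Aᶜ) (U := U) (U ω)
      have h2 := partialCdf_le (P := P) (B := Aᶜ) (U := U) (U ω)
      constructor <;> linarith
  · suffices h : P.real {ω | glueRV P A U V ω ≤ w} = w by
      rw [← ofReal_measureReal, h]
    have hon : {ω | glueRV P A U V ω ≤ w} ∩ A
        = A ∩ {ω | partialCdf P A V (V ω) ≤ w - (1 - P.real A)} := by
      ext ω
      simp only [Set.mem_inter_iff, Set.mem_ofPred_eq]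
      constructor
      · rintro ⟨h, hA⟩
        rw [glueRV_of_mem hA] at h
        exact ⟨hA, by linarith⟩
      · rintro ⟨hA, h⟩
        rw [glueRV_of_mem hA]
        exact ⟨by linarith, hA⟩
    have hoff : {ω | glueRV P A U V ω ≤ w} \ A
        = Aᶜ ∩ {ω | partialCdf P Aᶜ U (U ω) ≤ w} := by
      ext ω
      simp only [Set.mem_inter_iff, Set.mem_ofPred_eq, Set.mem_sdiff, Set.mem_compl_iff]
      constructor
      · rintro ⟨h, hA⟩
        rw [glueRV_of_notMem hA] at h
        exact ⟨hA, h⟩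
      · rintro ⟨hA, h⟩
        rw [glueRV_of_notMem hA]
        exact ⟨h, hA⟩
    rw [← measureReal_inter_add_sdiff hA, hon, hoff]
    rcases le_total w (1 - P.real A) with h | h
    · rw [measureReal_partialCdf_le hU hA.compl hw.1 (by linarith)]
      have : P.real (A ∩ {ω | partialCdf P A V (V ω) ≤ w - (1 - P.real A)}) ≤ 0 := by
        calc _ ≤ P.real (A ∩ {ω | partialCdf P A V (V ω) ≤ 0}) := by
              refine measureReal_mono (Set.inter_subset_inter_right _ fun ω hω => ?_)
              have hω' : partialCdf P A V (V ω) ≤ w - (1 - P.real A) := hω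
              exact hω'.trans (by linarith)
          _ = 0 := measureReal_partialCdf_le hV hA le_rfl hA0
      rw [le_antisymm this measureReal_nonneg, zero_add]
    · have : Aᶜ ∩ {ω | partialCdf P Aᶜ U (U ω) ≤ w} = Aᶜ :=
        Set.inter_eq_left.2 fun ω _ => (partialCdf_le (U ω)).trans (by linarith)
      rw [this, measureReal_partialCdf_le hV hA (by linarith) (by linarith [hw.2]), hcompl]
      ring

lemma le_glueRV (hA : MeasurableSet A) (hV : IsUniformRV P V) {ω : Ω} (h : ω ∈ A) :
    V ω ≤ glueRV P A U V ω := by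
  rw [glueRV_of_mem h]
  have h1 := partialCdf_sub_le hV hA (hV.2.1 ω) ⟨zero_le_one, le_rfl⟩ (hV.2.1 ω).2
  rw [partialCdf_one hV] at h1
  linarith

lemma glueRV_le (hU : IsUniformRV P U) {ω : Ω} (h : ω ∉ A) : glueRV P A U V ω ≤ U ω := by
  rw [glueRV_of_notMem h]
  exact partialCdf_le_self hU (hU.2.1 ω)

lemma sub_le_glueRV (hA : MeasurableSet A) (hU : IsUniformRV P U) {ω : Ω} (h : ω ∉ A) :
    U ω - P.real A ≤ glueRV P A U V ω := by
  rw [glueRV_of_notMem h]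
  linarith [partialCdf_add_compl hU hA (hU.2.1 ω),
    partialCdf_le (P := P) (B := A) (U := U) (U ω)]

end Uniform

/-! ### The sublinear functional behind the norm -/

/-- The monotone extension of a distortion function to `ℝ`. -/
def distExt (σ : ℝ → ℝ) (x : ℝ) : ℝ≥0∞ :=
  if x < 0 then 0 else if x < 1 then ENNReal.ofReal (σ x) else ∞

/-- `sup E[σ(U) X]` over all uniform `U`. -/
def distExpect (P : Measure Ω) (σ : ℝ → ℝ) (X : Ω → ℝ≥0∞) : ℝ≥0∞ :=
  ⨆ (U : Ω → ℝ) (_ : IsUniformRV P U), ∫⁻ ω, ENNReal.ofReal (σ (U ω)) * X ω ∂P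

section DistExpect

variable {P : Measure Ω} {σ : ℝ → ℝ} {U : Ω → ℝ} {X Y : Ω → ℝ≥0∞} {c : ℝ≥0∞} {p : ℝ}

lemma distExt_of_mem {x : ℝ} (hx : x ∈ Set.Ico (0 : ℝ) 1) :
    distExt σ x = ENNReal.ofReal (σ x) := by
  simp [distExt, hx.1.not_gt, hx.2]

lemma monotone_distExt (hσ : IsDistortion σ) : Monotone (distExt σ) := by
  intro x y hxy
  by_cases hx : x < 0
  · simp [distExt, hx]
  by_cases hy : 1 ≤ y
  · have h : distExt σ y = ∞ := by
      simp [distExt, hy.not_gt, (zero_le_one.trans hy).not_gt]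
    simp [h]
  push Not at hx hy
  rw [distExt_of_mem ⟨hx, hxy.trans_lt hy⟩, distExt_of_mem ⟨hx.trans hxy, hy⟩]
  exact ENNReal.ofReal_le_ofReal (hσ.mono ⟨hx, hxy.trans_lt hy⟩ ⟨hx.trans hxy, hy⟩ hxy)

lemma continuousWithinAt_distExt (hσ : IsDistortion σ) {u : ℝ} (hu : u ∈ Set.Ioo (0 : ℝ) 1) :
    ContinuousWithinAt (distExt σ) (Set.Iic u) u := by
  rw [← continuousWithinAt_Iio_iff_Iic]
  have h : Filter.Tendsto (fun x => ENNReal.ofReal (σ x)) (nhdsWithin u (Set.Iio u))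
      (nhds (ENNReal.ofReal (σ u))) :=
    (ENNReal.continuous_ofReal.tendsto _).comp (hσ.left_continuous u hu)
  rw [ContinuousWithinAt, distExt_of_mem ⟨hu.1.le, hu.2⟩]
  refine h.congr' ?_
  filter_upwards [Ioo_mem_nhdsLT hu.1] with x hx
  rw [distExt_of_mem ⟨hx.1.le, hx.2.trans hu.2⟩]

lemma distExpect_mono (h : X ≤ᵐ[P] Y) : distExpect P σ X ≤ distExpect P σ Y :=
  iSup₂_mono fun U _ => lintegral_mono_ae (h.mono fun ω hω => by gcongr)

lemma distExpect_const_mul (hc : c ≠ ∞) :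
    distExpect P σ (fun ω => c * X ω) = c * distExpect P σ X := by
  simp only [distExpect, ENNReal.mul_iSup]
  refine iSup_congr fun U => iSup_congr fun _ => ?_
  rw [← lintegral_const_mul' _ _ hc]
  exact lintegral_congr fun ω => by ring

lemma sigmaPow_eq_distExpect {E : Type*} [NormedAddCommGroup E] (Y : Ω → E) :
    sigmaPow P σ p Y = distExpect P σ fun ω => ‖Y ω‖ₑ ^ p := rfl

lemma measurable_distExt_comp (hσ : IsDistortion σ) (hU : IsUniformRV P U) :
    Measurable fun ω => distExt σ (U ω) := (monotone_distExt hσ).measurable.comp hU.1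

variable [IsProbabilityMeasure P]

lemma IsUniformRV.ae_distExt_eq (hU : IsUniformRV P U) :
    ∀ᵐ ω ∂P, distExt σ (U ω) = ENNReal.ofReal (σ (U ω)) :=
  hU.ae_lt_one.mono fun ω h => distExt_of_mem ⟨(hU.2.1 ω).1, h⟩

lemma IsUniformRV.lintegral_distExt_eq (hU : IsUniformRV P U) :
    ∫⁻ ω, distExt σ (U ω) * X ω ∂P = ∫⁻ ω, ENNReal.ofReal (σ (U ω)) * X ω ∂P :=
  lintegral_congr_ae ((hU.ae_distExt_eq (σ := σ)).mono fun ω h => by simp only [h])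

lemma IsUniformRV.lintegral_le_distExpect (hU : IsUniformRV P U) :
    ∫⁻ ω, distExt σ (U ω) * X ω ∂P ≤ distExpect P σ X := by
  rw [hU.lintegral_distExt_eq]
  exact le_iSup₂_of_le U hU le_rfl

lemma distExpect_le (h : ∀ U, IsUniformRV P U → ∫⁻ ω, distExt σ (U ω) * X ω ∂P ≤ c) :
    distExpect P σ X ≤ c :=
  iSup₂_le fun U hU => by
    rw [← hU.lintegral_distExt_eq]
    exact h U hU

lemma distExpect_tsum_le (hσ : IsDistortion σ) {X : ℕ → Ω → ℝ≥0∞}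
    (hX : ∀ n, AEMeasurable (X n) P) :
    distExpect P σ (fun ω => ∑' n, X n ω) ≤ ∑' n, distExpect P σ (X n) := by
  refine distExpect_le fun U hU => ?_
  simp only [← ENNReal.tsum_mul_left]
  refine (lintegral_tsum fun n =>
    (measurable_distExt_comp hσ hU).aemeasurable.mul (hX n)).trans_le ?_
  exact ENNReal.tsum_le_tsum fun n => hU.lintegral_le_distExpect

lemma IsUniformRV.map_eq (hU : IsUniformRV P U) :
    P.map U = volume.restrict (Set.Icc (0 : ℝ) 1) := by
  have : IsFiniteMeasure (P.map U) := Measure.isFiniteMeasure_map P U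
  refine Measure.ext_of_Iic _ _ fun a => ?_
  rw [Measure.map_apply hU.1 measurableSet_Iic, Measure.restrict_apply measurableSet_Iic]
  rcases lt_or_ge a 0 with ha | ha
  · have h1 : U ⁻¹' Set.Iic a = ∅ := by
      ext ω
      simpa using ha.trans_le (hU.2.1 ω).1
    have h2 : Set.Iic a ∩ Set.Icc (0 : ℝ) 1 = ∅ := by
      ext x
      simp only [Set.mem_inter_iff, Set.mem_Iic, Set.mem_Icc, Set.mem_empty_iff_false, iff_false]
      rintro ⟨h, h', -⟩
      linarith
    rw [h1, h2, measure_empty, measure_empty]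
  · have h1 : U ⁻¹' Set.Iic a = {ω | U ω ≤ min a 1} := by
      ext ω
      simp [(hU.2.1 ω).2]
    have h2 : Set.Iic a ∩ Set.Icc (0 : ℝ) 1 = Set.Icc 0 (min a 1) := by
      ext x
      simp only [Set.mem_inter_iff, Set.mem_Iic, Set.mem_Icc, le_min_iff]
      tauto
    rw [h1, h2, hU.2.2 _ ⟨by positivity, min_le_right _ _⟩, Real.volume_Icc, sub_zero]

lemma IsDistortion.integrableOn (hσ : IsDistortion σ) : IntegrableOn σ (Set.Ioo (0 : ℝ) 1) := by
  by_contra h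
  have := hσ.integral_one
  rw [integral_undef h] at this
  exact zero_ne_one this

lemma IsDistortion.exists_pos (hσ : IsDistortion σ) : ∃ u ∈ Set.Ioo (0 : ℝ) 1, 0 < σ u := by
  by_contra! h
  have h0 : ∫ u in Set.Ioo (0 : ℝ) 1, σ u ≤ 0 :=
    setIntegral_nonpos measurableSet_Ioo fun u hu => h u hu
  rw [hσ.integral_one] at h0
  exact absurd h0 (by norm_num)

lemma distExpect_one_le (hσ : IsDistortion σ) : distExpect P σ (fun _ => 1) ≤ 1 := by
  refine distExpect_le fun U hU => ?_
  simp only [mul_one]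
  rw [← lintegral_map (monotone_distExt hσ).measurable hU.1, hU.map_eq,
    ← restrict_Ioo_eq_restrict_Icc,
    setLIntegral_congr_fun measurableSet_Ioo
      (g := fun u => ENNReal.ofReal (σ u)) fun u hu => distExt_of_mem ⟨hu.1.le, hu.2⟩,
    ← ofReal_integral_eq_lintegral_ofReal hσ.integrableOn
      (ae_restrict_of_forall_mem measurableSet_Ioo fun u hu => hσ.nonneg u ⟨hu.1.le, hu.2⟩),
    hσ.integral_one, ENNReal.ofReal_one]

lemma distExpect_le_of_le (hσ : IsDistortion σ) (hc : c ≠ ∞) (h : ∀ᵐ ω ∂P, X ω ≤ c) :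
    distExpect P σ X ≤ c := by
  calc distExpect P σ X ≤ distExpect P σ (fun _ => c * 1) :=
        distExpect_mono (h.mono fun ω hω => by simpa using hω)
    _ = c * distExpect P σ (fun _ => 1) := distExpect_const_mul hc
    _ ≤ c * 1 := by gcongr; exact distExpect_one_le hσ
    _ = c := mul_one c

/-- The `σ`-norm dominates a multiple of the `L¹`-norm. -/
lemma exists_lintegral_le_distExpect (hrich : ∃ U : Ω → ℝ, IsUniformRV P U)
    (hσ : IsDistortion σ) :
    ∃ K : ℝ≥0∞, K ≠ ∞ ∧ ∀ X : Ω → ℝ≥0∞, ∫⁻ ω, X ω ∂P ≤ K * distExpect P σ X := by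
  obtain ⟨U, hU⟩ := hrich
  obtain ⟨u, hu, hpos⟩ := hσ.exists_pos
  obtain ⟨N, hN⟩ := exists_nat_gt (1 / (1 - u))
  have hu1 : 0 < 1 - u := by linarith [hu.2]
  have hN0 : (0 : ℝ) < N := lt_trans (by positivity) hN
  have hNu : 1 / (N : ℝ) ≤ 1 - u := by
    rw [div_lt_iff₀ hu1] at hN
    rw [div_le_iff₀ hN0]
    linarith
  set c := ENNReal.ofReal (σ u) with hc
  have hc0 : c ≠ 0 := by simpa [hc] using hpos
  have hct : c ≠ ∞ := ENNReal.ofReal_ne_top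
  let A : Fin N → Set Ω := fun k =>
    {ω | U ω ≤ ((k : ℝ) + 1) / N} \ {ω | U ω ≤ (k : ℝ) / N}
  have hAm : ∀ k, MeasurableSet (A k) := fun k =>
    (hU.measurableSet_le _).diff (hU.measurableSet_le _)
  have hA : ∀ k, P.real (A k) ≤ 1 / N := by
    intro k
    have hk : ((k : ℕ) : ℝ) + 1 ≤ N := by exact_mod_cast k.2
    have h1 : ((k : ℕ) : ℝ) / N ≤ ((k : ℕ) + 1 : ℝ) / N := by gcongr; linarith
    have h2 : ((k : ℕ) + 1 : ℝ) / N ≤ 1 := by rw [div_le_one hN0]; exact hk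
    have h3 : 0 ≤ ((k : ℕ) : ℝ) / N := by positivity
    have hd : P.real (A k) = ((k : ℕ) + 1 : ℝ) / N - (k : ℕ) / N := by
      have hsub : {ω | U ω ≤ ((k : ℕ) : ℝ) / N} ⊆ {ω | U ω ≤ ((k : ℕ) + 1 : ℝ) / N} :=
        fun ω hω => le_trans hω h1
      rw [measureReal_sdiff hsub (hU.measurableSet_le _), hU.measureReal_le ⟨h3.trans h1, h2⟩,
        hU.measureReal_le ⟨h3, h1.trans h2⟩]
    rw [hd]
    exact le_of_eq (by ring)
  have hcover : ∀ᵐ ω ∂P, ω ∈ ⋃ k, A k := by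
    filter_upwards [hU.ae_pos] with ω hω
    have hx : 0 < U ω * N := by positivity
    have hx1 : U ω * N ≤ N := by nlinarith [(hU.2.1 ω).2]
    have hceil : 0 < ⌈U ω * N⌉₊ := Nat.ceil_pos.2 hx
    have hceil' : ⌈U ω * N⌉₊ ≤ N := Nat.ceil_le.2 hx1
    have hcast : ((⌈U ω * N⌉₊ - 1 : ℕ) : ℝ) = ⌈U ω * N⌉₊ - 1 := by
      rw [Nat.cast_sub hceil, Nat.cast_one]
    refine Set.mem_iUnion.2 ⟨⟨⌈U ω * N⌉₊ - 1, by omega⟩, ?_, ?_⟩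
    · simp only [Set.mem_ofPred_eq, hcast, sub_add_cancel]
      rw [le_div_iff₀ hN0]
      exact Nat.le_ceil _
    · simp only [Set.mem_ofPred_eq, hcast, not_le]
      rw [div_lt_iff₀ hN0]
      linarith [Nat.ceil_lt_add_one hx.le]
  refine ⟨c⁻¹ * N, ENNReal.mul_ne_top (ENNReal.inv_ne_top.2 hc0) (ENNReal.natCast_ne_top N),
    fun X => ?_⟩
  have hpiece : ∀ k, ∫⁻ ω in A k, X ω ∂P ≤ c⁻¹ * distExpect P σ X := by
    intro k
    have hW := isUniformRV_glueRV (hAm k) hU hU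
    have h1 : c * ∫⁻ ω in A k, X ω ∂P ≤ distExpect P σ X := by
      rw [← lintegral_const_mul' _ _ hct]
      calc ∫⁻ ω in A k, c * X ω ∂P
          ≤ ∫⁻ ω in A k, distExt σ (glueRV P (A k) U U ω) * X ω ∂P := by
            refine setLIntegral_mono' (hAm k) fun ω hω => ?_
            gcongr
            rw [hc, ← distExt_of_mem ⟨hu.1.le, hu.2⟩]
            refine monotone_distExt hσ ?_
            have := one_sub_le_glueRV (P := P) (U := U) (V := U) hω
            linarith [hA k]
        _ ≤ ∫⁻ ω, distExt σ (glueRV P (A k) U U ω) * X ω ∂P := setLIntegral_le_lintegral _ _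
        _ ≤ distExpect P σ X := hW.lintegral_le_distExpect
    calc ∫⁻ ω in A k, X ω ∂P = c⁻¹ * (c * ∫⁻ ω in A k, X ω ∂P) := by
          rw [← mul_assoc, ENNReal.inv_mul_cancel hc0 hct, one_mul]
      _ ≤ c⁻¹ * distExpect P σ X := by gcongr
  calc ∫⁻ ω, X ω ∂P = ∫⁻ ω in ⋃ k, A k, X ω ∂P := by
        rw [Measure.restrict_eq_self_of_ae_mem hcover]
    _ ≤ ∑' k, ∫⁻ ω in A k, X ω ∂P := lintegral_iUnion_le _ _
    _ ≤ ∑' _ : Fin N, c⁻¹ * distExpect P σ X := ENNReal.tsum_le_tsum hpiece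
    _ = c⁻¹ * N * distExpect P σ X := by
        rw [tsum_fintype, Finset.sum_const, Finset.card_univ, Fintype.card_fin, nsmul_eq_mul]
        ring

/-- The functional `distExpect` is order continuous along shrinking events. -/
lemma tendsto_distExpect_indicator (hσ : IsDistortion σ) (hX : Measurable X)
    (hXfin : ∀ ω, X ω ≠ ∞) (hfin : distExpect P σ X ≠ ∞) {A : ℕ → Set Ω}
    (hA : ∀ n, MeasurableSet (A n)) (hanti : Antitone A) (hempty : ⋂ n, A n = ∅) :
    Filter.Tendsto (fun n => distExpect P σ ((A n).indicator X)) Filter.atTop (nhds 0) := by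
  have hPA : Filter.Tendsto (fun n => P.real (A n)) Filter.atTop (nhds 0) := by
    have h := tendsto_measure_iInter_atTop (μ := P) (fun n => (hA n).nullMeasurableSet) hanti
      ⟨0, measure_ne_top _ _⟩
    rw [hempty, measure_empty] at h
    exact (ENNReal.tendsto_toReal ENNReal.zero_ne_top).comp h
  rw [ENNReal.tendsto_nhds_zero]
  intro ε hε
  rcases eq_or_ne (distExpect P σ X) 0 with h0 | h0
  · refine Filter.Eventually.of_forall fun n => ?_
    refine (distExpect_mono (Y := X) ?_).trans (h0.le.trans zero_le)
    exact Filter.Eventually.of_forall fun ω => Set.indicator_le_self _ _ ω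
  obtain ⟨U, hU, hUlt⟩ : ∃ U, IsUniformRV P U ∧
      distExpect P σ X - ε < ∫⁻ ω, distExt σ (U ω) * X ω ∂P := by
    have h := ENNReal.sub_lt_self hfin h0 hε.ne'
    rw [distExpect, lt_iSup_iff] at h
    obtain ⟨U, h⟩ := h
    obtain ⟨hU, h⟩ := lt_iSup_iff.1 h
    exact ⟨U, hU, by rwa [hU.lintegral_distExt_eq]⟩
  let W : ℕ → Ω → ℝ := fun n => glueRV P (A n) U U
  have hlim : Filter.Tendsto
      (fun n => ∫⁻ ω, distExt σ (W n ω) * (A n)ᶜ.indicator X ω ∂P) Filter.atTop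
      (nhds (∫⁻ ω, distExt σ (U ω) * X ω ∂P)) := by
    refine tendsto_lintegral_of_dominated_convergence (fun ω => distExt σ (U ω) * X ω)
      (fun n => ?_) (fun n => ?_) ?_ ?_
    · exact (measurable_distExt_comp hσ (isUniformRV_glueRV (hA n) hU hU)).mul
        (hX.indicator (hA n).compl)
    · refine Filter.Eventually.of_forall fun ω => ?_
      by_cases hω : ω ∈ A n
      · simp [hω]
      · simp only [Set.indicator_of_mem (Set.mem_compl hω)]
        gcongr
        exact monotone_distExt hσ (glueRV_le hU hω)
    · exact ne_top_of_le_ne_top hfin hU.lintegral_le_distExpect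
    · filter_upwards [hU.ae_pos, hU.ae_lt_one] with ω h0 h1
      obtain ⟨m, hm⟩ : ∃ m, ω ∉ A m := by
        have : ω ∉ ⋂ n, A n := by simp [hempty]
        simpa using this
      have hev : ∀ᶠ n in Filter.atTop, ω ∉ A n :=
        (Filter.eventually_ge_atTop m).mono fun n hn h => hm (hanti hn h)
      have hW : Filter.Tendsto (fun n => W n ω) Filter.atTop
          (nhdsWithin (U ω) (Set.Iic (U ω))) := by
        refine tendsto_nhdsWithin_iff.2 ⟨?_, hev.mono fun n hn => glueRV_le hU hn⟩
        refine tendsto_of_tendsto_of_tendsto_of_le_of_le'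
          (g := fun n => U ω - P.real (A n)) (h := fun _ => U ω) ?_ tendsto_const_nhds
          (hev.mono fun n hn => sub_le_glueRV (hA n) hU hn)
          (hev.mono fun n hn => glueRV_le hU hn)
        simpa using tendsto_const_nhds.sub hPA
      have hd := ((continuousWithinAt_distExt hσ ⟨h0, h1⟩).tendsto.comp hW)
      have hmul : Filter.Tendsto (fun n => distExt σ (W n ω) * X ω) Filter.atTop
          (nhds (distExt σ (U ω) * X ω)) := by
        refine ENNReal.Tendsto.mul_const hd (Or.inr ?_)
        exact hXfin ω
      refine hmul.congr' (hev.mono fun n hn => ?_)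
      simp only [Set.indicator_of_mem (Set.mem_compl hn)]
  filter_upwards [hlim.eventually_const_lt hUlt] with n hn
  set b := ∫⁻ ω, distExt σ (W n ω) * (A n)ᶜ.indicator X ω ∂P with hb
  have hbX : distExpect P σ X ≤ ε + b := by
    rw [add_comm]
    exact tsub_le_iff_right.1 hn.le
  refine distExpect_le fun V hV => ?_
  have hW' := isUniformRV_glueRV (hA n) hU hV
  set a := ∫⁻ ω, distExt σ (V ω) * (A n).indicator X ω ∂P with ha
  have hab : a + b ≤ distExpect P σ X := by
    have hm : Measurable fun ω => distExt σ (V ω) * (A n).indicator X ω :=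
      (measurable_distExt_comp hσ hV).mul (hX.indicator (hA n))
    rw [ha, hb, ← lintegral_add_left hm]
    refine (lintegral_mono fun ω => ?_).trans hW'.lintegral_le_distExpect
    by_cases hω : ω ∈ A n
    · simp only [Set.indicator_of_mem hω, Set.indicator_of_notMem (Set.notMem_compl_iff.2 hω),
        mul_zero, add_zero]
      gcongr
      exact monotone_distExt hσ (le_glueRV (hA n) hV hω)
    · simp only [Set.indicator_of_notMem hω, Set.indicator_of_mem (Set.mem_compl hω), mul_zero,
        zero_add, W, glueRV_of_notMem hω, le_refl]
  have hbt : b ≠ ∞ := ne_top_of_le_ne_top hfin (le_add_self.trans hab)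
  exact ENNReal.le_of_add_le_add_right hbt (hab.trans hbX)

end DistExpect

/-! ### The space `L_σ^p` -/

section SigmaNorm

variable {P : Measure Ω} {σ : ℝ → ℝ} {p : ℝ} {Y Y' Z : Ω → 𝕂} {c : ℝ}

lemma sigmaPow_mono (hp : 0 ≤ p) (h : ∀ᵐ ω ∂P, ‖Y ω‖ ≤ ‖Y' ω‖) :
    sigmaPow P σ p Y ≤ sigmaPow P σ p Y' :=
  distExpect_mono (h.mono fun _ hω => ENNReal.rpow_le_rpow (enorm_le_iff_norm_le.2 hω) hp)

lemma sigmaNorm_mono (hp : 0 ≤ p) (h : ∀ᵐ ω ∂P, ‖Y ω‖ ≤ ‖Y' ω‖) :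
    sigmaNorm P σ p Y ≤ sigmaNorm P σ p Y' :=
  ENNReal.rpow_le_rpow (sigmaPow_mono hp h) (by positivity)

lemma MemLsigma.of_norm_le (hp : 0 ≤ p) (hY' : MemLsigma P σ p Y')
    (hY : AEStronglyMeasurable Y P) (h : ∀ᵐ ω ∂P, ‖Y ω‖ ≤ ‖Y' ω‖) : MemLsigma P σ p Y :=
  ⟨hY, (sigmaPow_mono hp h).trans_lt hY'.2⟩

lemma MemLsigma.sigmaNorm_ne_top (hp : 0 ≤ p) (hY : MemLsigma P σ p Y) :
    sigmaNorm P σ p Y ≠ ∞ :=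
  ENNReal.rpow_ne_top_of_nonneg (by positivity) hY.2.ne

lemma sigmaPow_const_smul (hp : 0 ≤ p) (a : 𝕂) (Y : Ω → 𝕂) :
    sigmaPow P σ p (a • Y) = ‖a‖ₑ ^ p * sigmaPow P σ p Y := by
  rw [sigmaPow_eq_distExpect, sigmaPow_eq_distExpect,
    ← distExpect_const_mul (ENNReal.rpow_ne_top_of_nonneg hp enorm_ne_top)]
  simp only [Pi.smul_apply, smul_eq_mul, enorm_mul, ENNReal.mul_rpow_of_nonneg _ _ hp]

lemma MemLsigma.const_smul (hp : 0 ≤ p) (a : 𝕂) (hY : MemLsigma P σ p Y) :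
    MemLsigma P σ p (a • Y) := by
  refine ⟨hY.1.const_smul a, ?_⟩
  rw [sigmaPow_const_smul hp]
  exact ENNReal.mul_lt_top (ENNReal.rpow_lt_top_of_nonneg hp enorm_ne_top) hY.2

lemma sigmaNorm_const_smul (hp : 0 < p) (a : 𝕂) (Y : Ω → 𝕂) :
    sigmaNorm P σ p (a • Y) = ‖a‖ₑ * sigmaNorm P σ p Y := by
  rw [sigmaNorm, sigmaNorm, sigmaPow_const_smul hp.le,
    ENNReal.mul_rpow_of_nonneg _ _ (by positivity), one_div, ENNReal.rpow_rpow_inv hp.ne']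

variable [IsProbabilityMeasure P]

lemma sigmaPow_le_of_norm_le (hσ : IsDistortion σ) (hp : 0 ≤ p) (h : ∀ ω, ‖Y ω‖ ≤ c) :
    sigmaPow P σ p Y ≤ ENNReal.ofReal c ^ p := by
  refine distExpect_le_of_le hσ (ENNReal.rpow_ne_top_of_nonneg hp ENNReal.ofReal_ne_top)
    (Filter.Eventually.of_forall fun ω => ENNReal.rpow_le_rpow ?_ hp)
  exact (ofReal_norm (Y ω)).symm.trans_le (ENNReal.ofReal_le_ofReal (h ω))

lemma sigmaNorm_le_of_norm_le (hσ : IsDistortion σ) (hp : 0 < p) (h : ∀ ω, ‖Y ω‖ ≤ c) :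
    sigmaNorm P σ p Y ≤ ENNReal.ofReal c := by
  rw [sigmaNorm, one_div, ENNReal.rpow_inv_le_iff hp]
  exact sigmaPow_le_of_norm_le hσ hp.le h

lemma MemLsigma.of_bound (hσ : IsDistortion σ) (hp : 0 ≤ p) (hY : AEStronglyMeasurable Y P)
    (h : ∀ ω, ‖Y ω‖ ≤ c) : MemLsigma P σ p Y :=
  ⟨hY, (sigmaPow_le_of_norm_le hσ hp h).trans_lt
    (ENNReal.rpow_lt_top_of_nonneg hp ENNReal.ofReal_ne_top)⟩

lemma MemLsigma.indicator_const (hσ : IsDistortion σ) (hp : 0 ≤ p) {A : Set Ω}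
    (hA : MeasurableSet A) (a : 𝕂) : MemLsigma P σ p (A.indicator fun _ => a) :=
  MemLsigma.of_bound hσ hp (aestronglyMeasurable_const.indicator hA)
    fun ω => norm_indicator_le_norm_self (fun _ => a) ω

lemma ae_eq_zero_of_sigmaNorm_eq_zero (hrich : ∃ U : Ω → ℝ, IsUniformRV P U)
    (hσ : IsDistortion σ) (hp : 0 < p) (hY : AEStronglyMeasurable Y P)
    (h : sigmaNorm P σ p Y = 0) : Y =ᵐ[P] 0 := by
  obtain ⟨K, -, hK⟩ := exists_lintegral_le_distExpect hrich hσ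
  have h0 : sigmaPow P σ p Y = 0 := by
    rw [sigmaNorm, ENNReal.rpow_eq_zero_iff] at h
    rcases h with h | h
    · exact h.1
    · exact absurd h.2 (not_lt.2 (by positivity))
  have h1 := hK fun ω => ‖Y ω‖ₑ ^ p
  rw [← sigmaPow_eq_distExpect, h0, mul_zero, nonpos_iff_eq_zero,
    lintegral_eq_zero_iff' (hY.enorm.pow_const p)] at h1
  filter_upwards [h1] with ω hω
  simpa [hp.not_gt, hp] using hω

lemma tendsto_sigmaNorm_indicator (hσ : IsDistortion σ) (hp : 0 < p)
    (hYm : StronglyMeasurable Y) (hY : MemLsigma P σ p Y) {A : ℕ → Set Ω}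
    (hA : ∀ n, MeasurableSet (A n)) (hanti : Antitone A) (hempty : ⋂ n, A n = ∅) :
    Filter.Tendsto (fun n => (sigmaNorm P σ p ((A n).indicator Y)).toReal) Filter.atTop
      (nhds 0) := by
  have h := tendsto_distExpect_indicator (X := fun ω => ‖Y ω‖ₑ ^ p) hσ
    (hYm.measurable.enorm.pow_const p)
    (fun ω => ENNReal.rpow_ne_top_of_nonneg hp.le enorm_ne_top) hY.2.ne hA hanti hempty
  have heq : ∀ n, sigmaNorm P σ p ((A n).indicator Y)
      = distExpect P σ ((A n).indicator fun ω => ‖Y ω‖ₑ ^ p) ^ (1 / p) := by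
    intro n
    rw [sigmaNorm, sigmaPow_eq_distExpect]
    congr 2
    ext ω
    by_cases hω : ω ∈ A n <;> simp [hω, hp]
  have h2 := (ENNReal.continuous_rpow_const (y := 1 / p)).tendsto 0 |>.comp h
  rw [ENNReal.zero_rpow_of_pos (by positivity)] at h2
  have h3 := (ENNReal.tendsto_toReal ENNReal.zero_ne_top).comp h2
  simp only [heq]
  exact h3

/-- Functionals induced by the Köthe dual are bounded on the unit ball. -/
lemma KoetheDual.bddAbove (hrich : ∃ U : Ω → ℝ, IsUniformRV P U) (hσ : IsDistortion σ)
    (hp : 1 ≤ p) (hZ : KoetheDual P σ p Z) :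
    BddAbove {r : ℝ | ∃ Y : Ω → 𝕂, MemLsigma P σ p Y ∧ sigmaNorm P σ p Y ≤ 1 ∧
        r = ‖∫ ω, Z ω * Y ω ∂P‖} := by
  have hp0 : 0 < p := by linarith
  by_contra hb
  rw [not_bddAbove_iff] at hb
  have hex : ∀ n : ℕ, ∃ Y : Ω → 𝕂, MemLsigma P σ p Y ∧ sigmaNorm P σ p Y ≤ 1 ∧
      (4 : ℝ) ^ n < ‖∫ ω, Z ω * Y ω ∂P‖ := by
    intro n
    obtain ⟨r, ⟨Y, h1, h2, rfl⟩, h3⟩ := hb (4 ^ n)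
    exact ⟨Y, h1, h2, h3⟩
  choose Y hY hY1 hYlt using hex
  obtain ⟨K, hKt, hK⟩ := exists_lintegral_le_distExpect hrich hσ
  let G : Ω → ℝ≥0∞ := fun ω => ∑' n, (2⁻¹ : ℝ≥0∞) ^ n * ‖Y n ω‖ₑ ^ p
  have hGterm : ∀ n, AEMeasurable (fun ω => (2⁻¹ : ℝ≥0∞) ^ n * ‖Y n ω‖ₑ ^ p) P :=
    fun n => ((hY n).1.enorm.pow_const p).const_mul _
  have hGm : AEMeasurable G P := AEMeasurable.tsum hGterm
  have hG : distExpect P σ G ≤ 2 := by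
    refine (distExpect_tsum_le hσ hGterm).trans ?_
    have h2 : ∑' n : ℕ, (2⁻¹ : ℝ≥0∞) ^ n = 2 := by
      rw [ENNReal.tsum_geometric, ENNReal.one_sub_inv_two, inv_inv]
    refine le_trans ?_ h2.le
    refine ENNReal.tsum_le_tsum fun n => ?_
    rw [distExpect_const_mul (by simp)]
    have : distExpect P σ (fun ω => ‖Y n ω‖ₑ ^ p) ≤ 1 := by
      have h := hY1 n
      rwa [sigmaNorm, one_div, ENNReal.rpow_inv_le_iff hp0, ENNReal.one_rpow] at h
    exact mul_le_of_le_one_right' this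
  have hGlt : ∀ᵐ ω ∂P, G ω < ∞ := by
    refine ae_lt_top' hGm (ne_top_of_le_ne_top ?_ (hK G))
    exact ENNReal.mul_ne_top hKt (ne_top_of_le_ne_top ENNReal.ofNat_ne_top hG)
  let R : Ω → 𝕂 := fun ω => (((G ω ^ (1 / p)).toReal : ℝ) : 𝕂)
  have hRnorm : ∀ ω, ‖R ω‖ₑ = ENNReal.ofReal (G ω ^ (1 / p)).toReal := by
    intro ω
    rw [← ofReal_norm, RCLike.norm_ofReal, abs_of_nonneg ENNReal.toReal_nonneg]
  have hR : MemLsigma P σ p R := by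
    refine ⟨?_, ?_⟩
    · exact (RCLike.continuous_ofReal.measurable.comp_aemeasurable
        (hGm.pow_const _).ennreal_toReal).aestronglyMeasurable
    · refine lt_of_le_of_lt ?_ (hG.trans_lt ENNReal.ofNat_lt_top)
      refine distExpect_mono (Filter.Eventually.of_forall fun ω => ?_)
      change ‖R ω‖ₑ ^ p ≤ G ω
      rw [hRnorm, ← ENNReal.le_rpow_inv_iff hp0, ← one_div]
      exact ENNReal.ofReal_toReal_le
  have hle : ∀ n, ∀ᵐ ω ∂P, ‖Y n ω‖ ≤ 2 ^ n * ‖R ω‖ := by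
    intro n
    filter_upwards [hGlt] with ω hω
    have h1 : (2⁻¹ : ℝ≥0∞) ^ n * ‖Y n ω‖ₑ ^ p ≤ G ω := ENNReal.le_tsum n
    have h2 : ‖Y n ω‖ₑ ^ p ≤ 2 ^ n * G ω := by
      calc ‖Y n ω‖ₑ ^ p = 2 ^ n * ((2⁻¹ : ℝ≥0∞) ^ n * ‖Y n ω‖ₑ ^ p) := by
            rw [← mul_assoc, ← mul_pow, ENNReal.mul_inv_cancel two_ne_zero ENNReal.ofNat_ne_top,
              one_pow, one_mul]
        _ ≤ 2 ^ n * G ω := by gcongr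
    have h3 : ‖Y n ω‖ₑ ≤ 2 ^ n * ‖R ω‖ₑ := by
      rw [hRnorm, ENNReal.ofReal_toReal (ENNReal.rpow_ne_top_of_nonneg (by positivity) hω.ne)]
      calc ‖Y n ω‖ₑ ≤ (2 ^ n * G ω) ^ (1 / p) := by
            rwa [one_div, ENNReal.le_rpow_inv_iff hp0]
        _ = (2 ^ n) ^ (1 / p) * G ω ^ (1 / p) :=
            ENNReal.mul_rpow_of_nonneg _ _ (by positivity)
        _ ≤ (2 ^ n) ^ (1 : ℝ) * G ω ^ (1 / p) := by
            gcongr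
            · exact one_le_pow₀ one_le_two
            · rw [div_le_one hp0]
              exact hp
        _ = 2 ^ n * G ω ^ (1 / p) := by rw [ENNReal.rpow_one]
    have h4 := ENNReal.toReal_mono (ENNReal.mul_ne_top (by simp) enorm_ne_top) h3
    simpa using h4
  have hint := (hZ.2 R hR).norm
  have hbound : ∀ n : ℕ, (2 : ℝ) ^ n ≤ ∫ ω, ‖Z ω * R ω‖ ∂P := by
    intro n
    have h1 : ‖∫ ω, Z ω * Y n ω ∂P‖ ≤ ∫ ω, 2 ^ n * ‖Z ω * R ω‖ ∂P := by
      refine norm_integral_le_of_norm_le (hint.const_mul _) ((hle n).mono fun ω hω => ?_)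
      rw [norm_mul, norm_mul]
      calc ‖Z ω‖ * ‖Y n ω‖ ≤ ‖Z ω‖ * (2 ^ n * ‖R ω‖) := by gcongr
        _ = 2 ^ n * (‖Z ω‖ * ‖R ω‖) := by ring
    rw [integral_const_mul] at h1
    have h2 : (2 : ℝ) ^ n * 2 ^ n ≤ 2 ^ n * ∫ ω, ‖Z ω * R ω‖ ∂P := by
      rw [← mul_pow, show (2 : ℝ) * 2 = 4 by norm_num]
      exact (hYlt n).le.trans h1
    exact le_of_mul_le_mul_left h2 (by positivity)
  obtain ⟨n, hn⟩ := pow_unbounded_of_one_lt (∫ ω, ‖Z ω * R ω‖ ∂P) one_lt_two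
  exact absurd (hbound n) (not_le.2 hn)

lemma KoetheDual.enorm_integral_le (hrich : ∃ U : Ω → ℝ, IsUniformRV P U)
    (hσ : IsDistortion σ) (hp : 1 ≤ p) (hZ : KoetheDual P σ p Z) (hY : MemLsigma P σ p Y) :
    ENNReal.ofReal ‖∫ ω, Z ω * Y ω ∂P‖
        ≤ ENNReal.ofReal (sSup {r : ℝ | ∃ Y' : Ω → 𝕂, MemLsigma P σ p Y' ∧
            sigmaNorm P σ p Y' ≤ 1 ∧ r = ‖∫ ω, Z ω * Y' ω ∂P‖}) * sigmaNorm P σ p Y := by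
  have hp0 : 0 < p := by linarith
  have hb := hZ.bddAbove hrich hσ hp
  set S := {r : ℝ | ∃ Y' : Ω → 𝕂, MemLsigma P σ p Y' ∧
            sigmaNorm P σ p Y' ≤ 1 ∧ r = ‖∫ ω, Z ω * Y' ω ∂P‖} with hS
  have hfin := hY.sigmaNorm_ne_top hp0.le
  rcases eq_or_ne (sigmaNorm P σ p Y) 0 with h0 | h0
  · have hY0 := ae_eq_zero_of_sigmaNorm_eq_zero hrich hσ hp0 hY.1 h0
    have : ∫ ω, Z ω * Y ω ∂P = 0 := by
      rw [integral_eq_zero_of_ae]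
      filter_upwards [hY0] with ω hω
      simp [hω]
    simp [this]
  · set t := (sigmaNorm P σ p Y).toReal with ht
    have ht0 : 0 < t := ENNReal.toReal_pos h0 hfin
    have hofreal : ENNReal.ofReal t = sigmaNorm P σ p Y := ENNReal.ofReal_toReal hfin
    have hmem : t⁻¹ * ‖∫ ω, Z ω * Y ω ∂P‖ ∈ S := by
      refine ⟨((t⁻¹ : ℝ) : 𝕂) • Y, hY.const_smul hp0.le _, ?_, ?_⟩
      · rw [sigmaNorm_const_smul hp0, ← hofreal, ← ofReal_norm, RCLike.norm_ofReal,
          abs_of_pos (by positivity), ← ENNReal.ofReal_mul (by positivity),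
          inv_mul_cancel₀ ht0.ne', ENNReal.ofReal_one]
      · have : ∀ ω, Z ω * (((t⁻¹ : ℝ) : 𝕂) • Y) ω = ((t⁻¹ : ℝ) : 𝕂) * (Z ω * Y ω) := by
          intro ω
          rw [Pi.smul_apply, smul_eq_mul]
          ring
        simp_rw [this]
        rw [integral_const_mul, norm_mul, RCLike.norm_ofReal, abs_of_pos (by positivity)]
    have h1 := le_csSup hb hmem
    have h2 : ‖∫ ω, Z ω * Y ω ∂P‖ ≤ sSup S * t := by
      rwa [inv_mul_le_iff₀ ht0, mul_comm] at h1
    rw [← hofreal, ← ENNReal.ofReal_mul' ht0.le]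
    exact ENNReal.ofReal_le_ofReal h2

lemma KoetheDual.integrable (hσ : IsDistortion σ) (hp : 0 ≤ p) (hZ : KoetheDual P σ p Z) :
    Integrable Z P := by
  simpa using hZ.2 (fun _ => 1)
    (MemLsigma.of_bound (c := 1) hσ hp aestronglyMeasurable_const (by simp))

lemma KoetheDual.ae_eq (hσ : IsDistortion σ) (hp : 0 ≤ p) {Z₁ Z₂ : Ω → 𝕂}
    (h₁ : KoetheDual P σ p Z₁) (h₂ : KoetheDual P σ p Z₂)
    (h : ∀ Y : Ω → 𝕂, MemLsigma P σ p Y → ∫ ω, Z₁ ω * Y ω ∂P = ∫ ω, Z₂ ω * Y ω ∂P) :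
    Z₁ =ᵐ[P] Z₂ := by
  refine Integrable.ae_eq_of_forall_setIntegral_eq _ _ (h₁.integrable hσ hp)
    (h₂.integrable hσ hp) fun A hA _ => ?_
  have h3 := h _ (MemLsigma.indicator_const hσ hp hA 1)
  have h4 : ∀ Z : Ω → 𝕂, (fun ω => Z ω * A.indicator (fun _ => (1 : 𝕂)) ω) = A.indicator Z := by
    intro Z
    ext ω
    by_cases hω : ω ∈ A <;> simp [hω]
  rwa [h4, h4, integral_indicator hA, integral_indicator hA] at h3

end SigmaNorm

/-! ### Representation of continuous functionals -/

section Representation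

variable {P : Measure Ω} [IsProbabilityMeasure P] {σ : ℝ → ℝ} {p : ℝ} {φ : (Ω → 𝕂) → 𝕂} {C : ℝ}

/-- A functional on functions which restricts to a bounded linear functional on `L_σ^p`. -/
structure IsBoundedFunctional (P : Measure Ω) (σ : ℝ → ℝ) (p : ℝ) (φ : (Ω → 𝕂) → 𝕂)
    (C : ℝ) : Prop where
  add : ∀ Y₁ Y₂ : Ω → 𝕂, MemLsigma P σ p Y₁ → MemLsigma P σ p Y₂ →
    φ (Y₁ + Y₂) = φ Y₁ + φ Y₂
  smul : ∀ (c : 𝕂) (Y : Ω → 𝕂), MemLsigma P σ p Y → φ (c • Y) = c * φ Y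
  ae : ∀ Y₁ Y₂ : Ω → 𝕂, MemLsigma P σ p Y₁ → Y₁ =ᵐ[P] Y₂ → φ Y₁ = φ Y₂
  nonneg : 0 ≤ C
  bound : ∀ Y : Ω → 𝕂, MemLsigma P σ p Y → ‖φ Y‖ ≤ C * (sigmaNorm P σ p Y).toReal

namespace IsBoundedFunctional

lemma map_zero (hφ : IsBoundedFunctional P σ p φ C) (hσ : IsDistortion σ) (hp : 0 ≤ p) :
    φ 0 = 0 := by
  have h : MemLsigma P σ p (0 : Ω → 𝕂) :=
    MemLsigma.of_bound (c := 0) hσ hp aestronglyMeasurable_zero (by simp)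
  simpa using hφ.smul 0 0 h

lemma norm_le_of_bound (hφ : IsBoundedFunctional P σ p φ C) (hσ : IsDistortion σ) (hp : 0 < p)
    {Y : Ω → 𝕂} {c : ℝ} (hc : 0 ≤ c) (hY : AEStronglyMeasurable Y P) (h : ∀ ω, ‖Y ω‖ ≤ c) :
    ‖φ Y‖ ≤ C * c := by
  refine (hφ.bound Y (MemLsigma.of_bound hσ hp.le hY h)).trans ?_
  exact mul_le_mul_of_nonneg_left
    (ENNReal.toReal_le_of_le_ofReal hc (sigmaNorm_le_of_norm_le hσ hp h)) hφ.nonneg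

lemma tendsto_indicator (hφ : IsBoundedFunctional P σ p φ C) (hσ : IsDistortion σ) (hp : 0 < p)
    {Y : Ω → 𝕂} (hYm : StronglyMeasurable Y) (hY : MemLsigma P σ p Y) {A : ℕ → Set Ω}
    (hA : ∀ n, MeasurableSet (A n)) (hanti : Antitone A) (hempty : ⋂ n, A n = ∅) :
    Filter.Tendsto (fun n => φ ((A n)ᶜ.indicator Y)) Filter.atTop (nhds (φ Y)) := by
  have hmem : ∀ B : Set Ω, MeasurableSet B → MemLsigma P σ p (B.indicator Y) := fun B hB =>
    hY.of_norm_le hp.le (hY.1.indicator hB)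
      (Filter.Eventually.of_forall fun ω => norm_indicator_le_norm_self Y ω)
  rw [tendsto_iff_norm_sub_tendsto_zero]
  refine squeeze_zero (g := fun n => C * (sigmaNorm P σ p ((A n).indicator Y)).toReal)
    (fun n => norm_nonneg _) (fun n => ?_) ?_
  · have h : φ Y = φ ((A n).indicator Y) + φ ((A n)ᶜ.indicator Y) := by
      rw [← hφ.add _ _ (hmem _ (hA n)) (hmem _ (hA n).compl), Set.indicator_self_add_compl]
    rw [h, norm_sub_rev, add_sub_cancel_right]
    exact hφ.bound _ (hmem _ (hA n))
  · simpa using (tendsto_sigmaNorm_indicator hσ hp hYm hY hA hanti hempty).const_mul C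

lemma map_indicator_union (hφ : IsBoundedFunctional P σ p φ C) (hσ : IsDistortion σ)
    (hp : 0 ≤ p) {A B : Set Ω} (hA : MeasurableSet A) (hB : MeasurableSet B)
    (hAB : Disjoint A B) :
    φ ((A ∪ B).indicator fun _ => 1)
      = φ (A.indicator fun _ => 1) + φ (B.indicator fun _ => 1) := by
  rw [← hφ.add _ _ (MemLsigma.indicator_const hσ hp hA 1)
    (MemLsigma.indicator_const hσ hp hB 1), Set.indicator_union_of_disjoint hAB]
  rfl

lemma sum_map_indicator (hφ : IsBoundedFunctional P σ p φ C) (hσ : IsDistortion σ)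
    (hp : 0 ≤ p) {f : ℕ → Set Ω} (hf : ∀ i, MeasurableSet (f i))
    (hd : Pairwise (Function.onFun Disjoint f)) (s : Finset ℕ) :
    ∑ i ∈ s, φ ((f i).indicator fun _ => 1) = φ ((⋃ i ∈ s, f i).indicator fun _ => 1) := by
  classical
  induction s using Finset.induction_on with
  | empty =>
    have h0 : ((⋃ i ∈ (∅ : Finset ℕ), f i).indicator fun _ => (1 : 𝕂)) = 0 := by
      ext ω
      simp
    rw [h0, Finset.sum_empty, hφ.map_zero hσ hp]
  | insert a s has ih =>
    rw [Finset.sum_insert has, ih, Finset.set_biUnion_insert,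
      hφ.map_indicator_union hσ hp (hf a) (s.measurableSet_biUnion fun i _ => hf i)]
    rw [Set.disjoint_iUnion₂_right]
    exact fun i hi => hd fun h => has (h ▸ hi)

lemma hasSum_map_indicator (hφ : IsBoundedFunctional P σ p φ C) (hσ : IsDistortion σ)
    (hp : 0 < p) {f : ℕ → Set Ω} (hf : ∀ i, MeasurableSet (f i))
    (hd : Pairwise (Function.onFun Disjoint f)) :
    HasSum (fun i => φ ((f i).indicator fun _ => 1)) (φ ((⋃ i, f i).indicator fun _ => 1)) := by
  let A : ℕ → Set Ω := fun n => ⋃ i ∈ Set.Ici n, f i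
  have hAm : ∀ n, MeasurableSet (A n) := fun n =>
    MeasurableSet.biUnion (Set.to_countable _) fun i _ => hf i
  have hanti : Antitone A := fun m n h =>
    Set.biUnion_subset_biUnion_left (Set.Ici_subset_Ici.2 h)
  have hempty : ⋂ n, A n = ∅ := by
    ext ω
    simp only [Set.mem_iInter, Set.mem_empty_iff_false, iff_false, A, Set.mem_iUnion, Set.mem_Ici]
    intro h
    obtain ⟨i, -, hi⟩ := h 0
    obtain ⟨j, hj, hj'⟩ := h (i + 1)
    exact Set.disjoint_left.1 (hd (show i ≠ j by omega)) hi hj'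
  have hlim : Filter.Tendsto
      (fun n => C * (sigmaNorm P σ p ((A n).indicator fun _ => (1 : 𝕂))).toReal) Filter.atTop
      (nhds 0) := by
    simpa using (tendsto_sigmaNorm_indicator hσ hp stronglyMeasurable_const
      (MemLsigma.of_bound (c := 1) hσ hp.le aestronglyMeasurable_const (by simp))
      hAm hanti hempty).const_mul C
  rw [HasSum, SummationFilter.unconditional_filter, Metric.tendsto_nhds]
  intro ε hε
  obtain ⟨n, hn⟩ := (hlim.eventually_lt_const hε).exists
  filter_upwards [Filter.eventually_ge_atTop (Finset.range n)] with s hs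
  rw [hφ.sum_map_indicator hσ hp.le hf hd]
  let B : Set Ω := ⋃ i ∈ (s : Set ℕ)ᶜ, f i
  have hBm : MeasurableSet B := MeasurableSet.biUnion (Set.to_countable _) fun i _ => hf i
  have hsm : MeasurableSet (⋃ i ∈ s, f i) := s.measurableSet_biUnion fun i _ => hf i
  have hBA : B ⊆ A n := by
    refine Set.biUnion_subset_biUnion_left fun i hi => ?_
    by_contra h
    exact hi (hs (Finset.mem_range.2 (not_le.1 h)))
  have hunion : ⋃ i, f i = (⋃ i ∈ s, f i) ∪ B := by
    ext ω
    simp only [Set.mem_iUnion, Set.mem_union, B, Set.mem_compl_iff, Finset.mem_coe, exists_prop]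
    constructor
    · rintro ⟨i, hi⟩
      by_cases h : i ∈ s
      · exact Or.inl ⟨i, h, hi⟩
      · exact Or.inr ⟨i, h, hi⟩
    · rintro (⟨i, -, hi⟩ | ⟨i, -, hi⟩) <;> exact ⟨i, hi⟩
  have hdisj : Disjoint (⋃ i ∈ s, f i) B := by
    simp only [B, Set.disjoint_iUnion₂_right, Set.disjoint_iUnion₂_left]
    exact fun i hi j hj => hd fun h => hi (h ▸ hj)
  rw [hunion, hφ.map_indicator_union hσ hp.le hsm hBm hdisj, dist_eq_norm, norm_sub_rev,
    add_sub_cancel_left]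
  have hAmem : MemLsigma P σ p ((A n).indicator fun _ => (1 : 𝕂)) :=
    MemLsigma.indicator_const hσ hp.le (hAm n) 1
  refine ((hφ.bound _ (MemLsigma.indicator_const hσ hp.le hBm 1)).trans ?_).trans_lt hn
  refine mul_le_mul_of_nonneg_left (ENNReal.toReal_mono (hAmem.sigmaNorm_ne_top hp.le)
    (sigmaNorm_mono hp.le (Filter.Eventually.of_forall fun ω => ?_))) hφ.nonneg
  exact norm_indicator_le_of_subset hBA _ _

open Classical in
/-- The vector measure `A ↦ φ(1_A)`. -/
def toVectorMeasure (hφ : IsBoundedFunctional P σ p φ C) (hσ : IsDistortion σ) (hp : 0 < p) :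
    VectorMeasure Ω 𝕂 where
  measureOf' A := if MeasurableSet A then φ (A.indicator fun _ => 1) else 0
  empty' := by
    rw [if_pos MeasurableSet.empty, Set.indicator_empty]
    exact hφ.map_zero hσ hp.le
  not_measurable' _ hA := if_neg hA
  m_iUnion' f hf hd := by
    simp only [hf, if_true, MeasurableSet.iUnion hf]
    exact hφ.hasSum_map_indicator hσ hp hf hd

lemma toVectorMeasure_apply (hφ : IsBoundedFunctional P σ p φ C) (hσ : IsDistortion σ)
    (hp : 0 < p) {A : Set Ω} (hA : MeasurableSet A) :
    hφ.toVectorMeasure hσ hp A = φ (A.indicator fun _ => 1) := if_pos hA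

lemma exists_real_density (hφ : IsBoundedFunctional P σ p φ C) (hσ : IsDistortion σ)
    (hp : 0 < p) (l : 𝕂 →+ ℝ) (hl : Continuous l) :
    ∃ f : Ω → ℝ, Measurable f ∧ Integrable f P ∧
      ∀ A, MeasurableSet A → l (φ (A.indicator fun _ => 1)) = ∫ ω in A, f ω ∂P := by
  let ν : SignedMeasure Ω := (hφ.toVectorMeasure hσ hp).mapRange l hl
  have hν : ∀ A, MeasurableSet A → ν A = l (φ (A.indicator fun _ => 1)) := fun A hA => by
    rw [VectorMeasure.mapRange_apply, hφ.toVectorMeasure_apply hσ hp hA]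
  have hac : ν ≪ᵥ P.toENNRealVectorMeasure := by
    refine VectorMeasure.AbsolutelyContinuous.mk fun A hA h0 => ?_
    rw [Measure.toENNRealVectorMeasure_apply_measurable hA] at h0
    have hz : (A.indicator fun _ => (1 : 𝕂)) =ᵐ[P] 0 := indicator_meas_zero h0
    rw [hν A hA, hφ.ae _ _ (MemLsigma.indicator_const hσ hp.le hA 1) hz,
      hφ.map_zero hσ hp.le, _root_.map_zero]
  refine ⟨ν.rnDeriv P, SignedMeasure.measurable_rnDeriv _ _,
    SignedMeasure.integrable_rnDeriv _ _, fun A hA => ?_⟩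
  rw [← hν A hA, ← withDensityᵥ_apply (SignedMeasure.integrable_rnDeriv _ _) hA,
    SignedMeasure.withDensityᵥ_rnDeriv_eq _ _ hac]

lemma exists_density (hφ : IsBoundedFunctional P σ p φ C) (hσ : IsDistortion σ) (hp : 0 < p) :
    ∃ Z : Ω → 𝕂, Measurable Z ∧ Integrable Z P ∧
      ∀ A, MeasurableSet A → φ (A.indicator fun _ => 1) = ∫ ω in A, Z ω ∂P := by
  obtain ⟨f, hfm, hfi, hf⟩ := hφ.exists_real_density hσ hp RCLike.re RCLike.continuous_re
  obtain ⟨g, hgm, hgi, hg⟩ := hφ.exists_real_density hσ hp RCLike.im RCLike.continuous_im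
  refine ⟨fun ω => (f ω : 𝕂) + (g ω : 𝕂) * RCLike.I, ?_, ?_, fun A hA => ?_⟩
  · exact (RCLike.continuous_ofReal.measurable.comp hfm).add
      ((RCLike.continuous_ofReal.measurable.comp hgm).mul_const _)
  · exact hfi.ofReal.add (hgi.ofReal.mul_const _)
  · have hf' : Integrable (fun ω => (f ω : 𝕂)) (P.restrict A) := hfi.restrict.ofReal
    have hg' : Integrable (fun ω => (g ω : 𝕂) * RCLike.I) (P.restrict A) :=
      hgi.restrict.ofReal.mul_const _
    rw [integral_add hf' hg', integral_mul_const, integral_ofReal, integral_ofReal, ← hf A hA,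
      ← hg A hA]
    exact (RCLike.re_add_im _).symm

variable {Z : Ω → 𝕂}

lemma map_simpleFunc (hφ : IsBoundedFunctional P σ p φ C) (hσ : IsDistortion σ) (hp : 0 < p)
    (hZ : Integrable Z P)
    (hφZ : ∀ A, MeasurableSet A → φ (A.indicator fun _ => 1) = ∫ ω in A, Z ω ∂P)
    (f : SimpleFunc Ω 𝕂) : φ f = ∫ ω, Z ω * f ω ∂P := by
  have hbound : ∀ f : SimpleFunc Ω 𝕂, ∃ c : ℝ, ∀ ω, ‖f ω‖ ≤ c := fun f =>
    f.exists_forall_norm_le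
  have hmem : ∀ f : SimpleFunc Ω 𝕂, MemLsigma P σ p f := fun f =>
    MemLsigma.of_bound hσ hp.le f.aestronglyMeasurable (hbound f).choose_spec
  have hint : ∀ f : SimpleFunc Ω 𝕂, Integrable (fun ω => Z ω * f ω) P := fun f =>
    hZ.mul_bdd f.aestronglyMeasurable
      (Filter.Eventually.of_forall (hbound f).choose_spec)
  induction f using SimpleFunc.induction with
  | const c hs =>
    rename_i A
    have h1 : ⇑(SimpleFunc.piecewise A hs (SimpleFunc.const Ω c) (SimpleFunc.const Ω 0))
        = c • A.indicator fun _ => (1 : 𝕂) := by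
      ext ω
      by_cases hω : ω ∈ A <;> simp [hω]
    have h2 : (fun ω => Z ω * (c • A.indicator fun _ => (1 : 𝕂)) ω)
        = fun ω => c * A.indicator Z ω := by
      ext ω
      by_cases hω : ω ∈ A <;> simp [hω, mul_comm]
    rw [h1, hφ.smul _ _ (MemLsigma.indicator_const hσ hp.le hs 1), hφZ A hs, h2,
      integral_const_mul, integral_indicator hs]
  | add _ hf hg =>
    rename_i f g _
    rw [SimpleFunc.coe_add, hφ.add _ _ (hmem f) (hmem g), hf, hg,
      ← integral_add (hint f) (hint g)]
    simp only [Pi.add_apply, mul_add]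

end IsBoundedFunctional

/-- Bounded measurable functions are uniform limits of simple functions. -/
lemma exists_simpleFunc_norm_sub_le {Y : Ω → 𝕂} (hY : Measurable Y) {c : ℝ}
    (hc : ∀ ω, ‖Y ω‖ ≤ c) {ε : ℝ} (hε : 0 < ε) :
    ∃ f : SimpleFunc Ω 𝕂, ∀ ω, ‖Y ω - f ω‖ ≤ ε := by
  have hcomp : IsCompact (Metric.closedBall (0 : 𝕂) c) := isCompact_closedBall 0 c
  obtain ⟨e, he⟩ := TopologicalSpace.exists_dense_seq 𝕂
  obtain ⟨t, ht⟩ := hcomp.elim_finite_subcover (fun n => Metric.ball (e n) ε)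
    (fun n => Metric.isOpen_ball) fun x _ => by
      obtain ⟨n, hn⟩ := he.exists_dist_lt x hε
      exact Set.mem_iUnion.2 ⟨n, hn⟩
  refine ⟨(SimpleFunc.nearestPt e (t.sup id)).comp Y hY, fun ω => ?_⟩
  have hmem := ht (show Y ω ∈ Metric.closedBall (0 : 𝕂) c by simpa using hc ω)
  obtain ⟨n, hn, hYn⟩ := Set.mem_iUnion₂.1 hmem
  have h1 := SimpleFunc.edist_nearestPt_le e (Y ω) (Finset.le_sup (f := id) hn)
  rw [edist_dist, edist_dist, ENNReal.ofReal_le_ofReal_iff dist_nonneg] at h1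
  rw [← dist_eq_norm, dist_comm, SimpleFunc.coe_comp, Function.comp_apply]
  refine h1.trans ?_
  rw [dist_comm]
  exact (Metric.mem_ball.1 hYn).le

namespace IsBoundedFunctional

variable {Z : Ω → 𝕂}

lemma map_of_bound (hφ : IsBoundedFunctional P σ p φ C) (hσ : IsDistortion σ) (hp : 0 < p)
    (hZ : Integrable Z P)
    (hφZ : ∀ A, MeasurableSet A → φ (A.indicator fun _ => 1) = ∫ ω in A, Z ω ∂P)
    {Y : Ω → 𝕂} (hY : Measurable Y) {c : ℝ} (hc : ∀ ω, ‖Y ω‖ ≤ c) :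
    φ Y = ∫ ω, Z ω * Y ω ∂P := by
  rw [← sub_eq_zero, ← norm_le_zero_iff]
  set I := ∫ ω, ‖Z ω‖ ∂P with hI
  have hI0 : 0 ≤ I := integral_nonneg fun ω => norm_nonneg _
  have hC := hφ.nonneg
  have key : ∀ ε : ℝ, 0 < ε → ‖φ Y - ∫ ω, Z ω * Y ω ∂P‖ ≤ (C + I) * ε := by
    intro ε hε
    obtain ⟨f, hf⟩ := exists_simpleFunc_norm_sub_le hY hc hε
    obtain ⟨d, hd⟩ := f.exists_forall_norm_le
    have hfm : AEStronglyMeasurable f P := f.aestronglyMeasurable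
    have hsm : AEStronglyMeasurable (fun ω => Y ω - f ω) P := hY.aestronglyMeasurable.sub hfm
    have hdiff : MemLsigma P σ p (fun ω => Y ω - f ω) := MemLsigma.of_bound hσ hp.le hsm hf
    have hfmem : MemLsigma P σ p f := MemLsigma.of_bound hσ hp.le hfm hd
    have h1 : φ Y = φ (fun ω => Y ω - f ω) + ∫ ω, Z ω * f ω ∂P := by
      rw [← hφ.map_simpleFunc hσ hp hZ hφZ f, ← hφ.add _ _ hdiff hfmem]
      congr 1
      ext ω
      simp
    have hi1 : Integrable (fun ω => Z ω * (Y ω - f ω)) P :=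
      hZ.mul_bdd hsm (Filter.Eventually.of_forall hf)
    have hi2 : Integrable (fun ω => Z ω * f ω) P :=
      hZ.mul_bdd hfm (Filter.Eventually.of_forall hd)
    have h2 : ∫ ω, Z ω * Y ω ∂P = ∫ ω, Z ω * (Y ω - f ω) ∂P + ∫ ω, Z ω * f ω ∂P := by
      rw [← integral_add hi1 hi2]
      exact integral_congr_ae (Filter.Eventually.of_forall fun ω => by ring)
    rw [h1, h2, add_sub_add_right_eq_sub]
    refine (norm_sub_le _ _).trans ?_
    rw [add_mul]
    refine add_le_add (hφ.norm_le_of_bound hσ hp hε.le hsm hf) ?_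
    rw [hI, ← integral_mul_const]
    refine norm_integral_le_of_norm_le (hZ.norm.mul_const _)
      (Filter.Eventually.of_forall fun ω => ?_)
    rw [norm_mul]
    exact mul_le_mul_of_nonneg_left (hf ω) (norm_nonneg _)
  refine le_of_forall_pos_le_add fun ε hε => ?_
  refine (key (ε / (C + I + 1)) (by positivity)).trans ?_
  rw [zero_add, mul_div_assoc', div_le_iff₀ (by positivity)]
  nlinarith

lemma integrable_and_map_eq (hφ : IsBoundedFunctional P σ p φ C) (hσ : IsDistortion σ)
    (hp : 0 < p) (hZm : Measurable Z) (hZ : Integrable Z P)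
    (hφZ : ∀ A, MeasurableSet A → φ (A.indicator fun _ => 1) = ∫ ω in A, Z ω ∂P)
    {Y : Ω → 𝕂} (hYm : StronglyMeasurable Y) (hY : MemLsigma P σ p Y) :
    Integrable (fun ω => Z ω * Y ω) P ∧ φ Y = ∫ ω, Z ω * Y ω ∂P := by
  let A : ℕ → Set Ω := fun n => {ω | (n : ℝ) < ‖Y ω‖}
  have hA : ∀ n, MeasurableSet (A n) := fun n =>
    measurableSet_lt measurable_const hYm.measurable.norm
  have hanti : Antitone A := fun m n hmn ω (hω : (n : ℝ) < ‖Y ω‖) =>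
    lt_of_le_of_lt (Nat.cast_le.2 hmn) hω
  have hempty : ⋂ n, A n = ∅ := by
    ext ω
    obtain ⟨n, hn⟩ := exists_nat_ge ‖Y ω‖
    simp only [Set.mem_iInter, Set.mem_empty_iff_false, iff_false, not_forall]
    exact ⟨n, not_lt.2 hn⟩
  have hcover : AECover P Filter.atTop fun n => (A n)ᶜ := by
    refine ⟨Filter.Eventually.of_forall fun ω => ?_, fun n => (hA n).compl⟩
    obtain ⟨n, hn⟩ := exists_nat_ge ‖Y ω‖
    filter_upwards [Filter.eventually_ge_atTop n] with m hm
    exact not_lt.2 (hn.trans (Nat.cast_le.2 hm))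
  have hbd : ∀ n, ∀ ω, ‖(A n)ᶜ.indicator Y ω‖ ≤ n := by
    intro n ω
    by_cases hω : ω ∈ A n
    · simp [hω]
    · rw [Set.indicator_of_mem (Set.mem_compl hω)]
      exact not_lt.1 hω
  have hind : ∀ n, (fun ω => Z ω * (A n)ᶜ.indicator Y ω)
      = (A n)ᶜ.indicator fun ω => Z ω * Y ω := by
    intro n
    ext ω
    by_cases hω : ω ∈ A n <;> simp [hω]
  have hint : Integrable (fun ω => Z ω * Y ω) P := by
    refine hcover.integrable_of_integral_norm_bounded (C * (sigmaNorm P σ p Y).toReal)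
      (fun n => ?_) (Filter.Eventually.of_forall fun n => ?_)
    · rw [← integrable_indicator_iff (hA n).compl, ← hind]
      exact hZ.mul_bdd (hYm.measurable.indicator (hA n).compl).aestronglyMeasurable
        (Filter.Eventually.of_forall (hbd n))
    · let W : Ω → 𝕂 := fun ω =>
        (‖(A n)ᶜ.indicator Y ω‖ : 𝕂) * ((starRingEnd 𝕂) (Z ω) / (‖Z ω‖ : 𝕂))
      have hWm : Measurable W := by
        refine Measurable.mul ?_ (Measurable.div ?_ ?_)
        · exact RCLike.continuous_ofReal.measurable.comp
            (hYm.measurable.indicator (hA n).compl).norm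
        · exact RCLike.continuous_conj.measurable.comp hZm
        · exact RCLike.continuous_ofReal.measurable.comp hZm.norm
      have hWn : ∀ ω, ‖W ω‖ ≤ ‖(A n)ᶜ.indicator Y ω‖ := by
        intro ω
        simp only [W, norm_mul, norm_div, RCLike.norm_ofReal, abs_norm, RCLike.norm_conj]
        exact mul_le_of_le_one_right (norm_nonneg _) (div_self_le_one _)
      have hWY : ∀ ω, ‖W ω‖ ≤ ‖Y ω‖ := fun ω =>
        (hWn ω).trans (norm_indicator_le_norm_self _ _)
      have hZW : ∀ ω, Z ω * W ω = (((A n)ᶜ.indicator (fun ω => ‖Z ω * Y ω‖) ω : ℝ) : 𝕂) := by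
        intro ω
        have h1 : Z ω * ((starRingEnd 𝕂) (Z ω) / (‖Z ω‖ : 𝕂)) = (‖Z ω‖ : 𝕂) := by
          rw [mul_div_assoc', RCLike.mul_conj, sq, mul_self_div_self]
        have h2 : Z ω * W ω = (‖(A n)ᶜ.indicator Y ω‖ : 𝕂) * (‖Z ω‖ : 𝕂) := by
          rw [← h1]
          simp only [W]
          ring
        rw [h2]
        by_cases hω : ω ∈ A n
        · simp [hω]
        · simp [hω, mul_comm]
      have h3 := hφ.map_of_bound hσ hp hZ hφZ hWm fun ω => (hWn ω).trans (hbd n ω)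
      simp only [hZW] at h3
      rw [integral_ofReal, integral_indicator (hA n).compl] at h3
      have h4 := hφ.bound W (hY.of_norm_le hp.le hWm.aestronglyMeasurable
        (Filter.Eventually.of_forall hWY))
      rw [h3, RCLike.norm_ofReal] at h4
      refine (le_abs_self _).trans (h4.trans ?_)
      exact mul_le_mul_of_nonneg_left (ENNReal.toReal_mono (hY.sigmaNorm_ne_top hp.le)
        (sigmaNorm_mono hp.le (Filter.Eventually.of_forall hWY))) hφ.nonneg
  refine ⟨hint, tendsto_nhds_unique (hφ.tendsto_indicator hσ hp hYm hY hA hanti hempty) ?_⟩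
  refine (hcover.integral_tendsto_of_countably_generated hint).congr fun n => ?_
  rw [hφ.map_of_bound hσ hp hZ hφZ (hYm.measurable.indicator (hA n).compl) (hbd n), hind,
    integral_indicator (hA n).compl]

theorem exists_koetheDual (hφ : IsBoundedFunctional P σ p φ C) (hσ : IsDistortion σ)
    (hp : 0 < p) :
    ∃ Z : Ω → 𝕂, KoetheDual P σ p Z ∧
      ∀ Y : Ω → 𝕂, MemLsigma P σ p Y → φ Y = ∫ ω, Z ω * Y ω ∂P := by
  obtain ⟨Z, hZm, hZ, hφZ⟩ := hφ.exists_density hσ hp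
  have key : ∀ Y : Ω → 𝕂, MemLsigma P σ p Y →
      Integrable (fun ω => Z ω * Y ω) P ∧ φ Y = ∫ ω, Z ω * Y ω ∂P := by
    intro Y hY
    have hae := hY.1.ae_eq_mk
    have hmk : MemLsigma P σ p (hY.1.mk Y) := hY.of_norm_le hp.le
      hY.1.stronglyMeasurable_mk.aestronglyMeasurable (hae.mono fun ω h => by rw [h])
    obtain ⟨h1, h2⟩ :=
      hφ.integrable_and_map_eq hσ hp hZm hZ hφZ hY.1.stronglyMeasurable_mk hmk
    have hmul : (fun ω => Z ω * hY.1.mk Y ω) =ᵐ[P] fun ω => Z ω * Y ω :=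
      hae.mono fun ω h => by simp only [h]
    exact ⟨h1.congr hmul, by rw [hφ.ae _ _ hY hae, h2, integral_congr_ae hmul]⟩
  exact ⟨Z, ⟨hZm.aestronglyMeasurable, fun Y hY => (key Y hY).1⟩, fun Y hY => (key Y hY).2⟩

end IsBoundedFunctional

end Representation

/-- For every `Z` in the Köthe dual of `L_σ^p(P)`, the functional
`φ_Z(Y) = E(ZY)` is a continuous linear functional with operator norm
`sup{|E(ZY)| : ‖Y‖_{σ,p} ≤ 1} < ∞`, and `Z ↦ φ_Z` is a linear bijection from the
Köthe dual onto the continuous dual of `L_σ^p(P)`. -/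
theorem statement9
    (P : Measure Ω) [IsProbabilityMeasure P]
    (hrich : ∃ U : Ω → ℝ, IsUniformRV P U)
    {𝕂 : Type*} [RCLike 𝕂]
    (σ : ℝ → ℝ) (hσ : IsDistortion σ) (p : ℝ) (hp : 1 ≤ p) :
    -- `φ_Z` is bounded on the unit ball: the supremum defining `‖Φ(Z)‖` is finite
    (∀ Z : Ω → 𝕂, KoetheDual P σ p Z →
      BddAbove {r : ℝ | ∃ Y : Ω → 𝕂, MemLsigma P σ p Y ∧ sigmaNorm P σ p Y ≤ 1 ∧
        r = ‖∫ ω, Z ω * Y ω ∂P‖}) ∧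
    -- `φ_Z` is continuous: `|E(ZY)| ≤ ‖Φ(Z)‖·‖Y‖_{σ,p}`
    (∀ Z : Ω → 𝕂, KoetheDual P σ p Z → ∀ Y : Ω → 𝕂, MemLsigma P σ p Y →
      ENNReal.ofReal ‖∫ ω, Z ω * Y ω ∂P‖
        ≤ ENNReal.ofReal (sSup {r : ℝ | ∃ Y' : Ω → 𝕂, MemLsigma P σ p Y' ∧
            sigmaNorm P σ p Y' ≤ 1 ∧ r = ‖∫ ω, Z ω * Y' ω ∂P‖}) * sigmaNorm P σ p Y) ∧
    -- injectivity of `Φ`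
    (∀ Z₁ Z₂ : Ω → 𝕂, KoetheDual P σ p Z₁ → KoetheDual P σ p Z₂ →
      (∀ Y : Ω → 𝕂, MemLsigma P σ p Y → ∫ ω, Z₁ ω * Y ω ∂P = ∫ ω, Z₂ ω * Y ω ∂P) →
      Z₁ =ᵐ[P] Z₂) ∧
    -- surjectivity of `Φ` onto the continuous dual: every a.e.-invariant continuous
    -- linear functional on `L_σ^p(P)` is of the form `φ_Z`
    (∀ φ : (Ω → 𝕂) → 𝕂,
      (∀ Y₁ Y₂ : Ω → 𝕂, MemLsigma P σ p Y₁ → MemLsigma P σ p Y₂ →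
        φ (Y₁ + Y₂) = φ Y₁ + φ Y₂) →
      (∀ (c : 𝕂) (Y : Ω → 𝕂), MemLsigma P σ p Y → φ (c • Y) = c * φ Y) →
      (∀ Y₁ Y₂ : Ω → 𝕂, MemLsigma P σ p Y₁ → Y₁ =ᵐ[P] Y₂ → φ Y₁ = φ Y₂) →
      (∃ C : ℝ, ∀ Y : Ω → 𝕂, MemLsigma P σ p Y →
        ‖φ Y‖ ≤ C * (sigmaNorm P σ p Y).toReal) →
      ∃ Z : Ω → 𝕂, KoetheDual P σ p Z ∧
        ∀ Y : Ω → 𝕂, MemLsigma P σ p Y → φ Y = ∫ ω, Z ω * Y ω ∂P) := by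
  have hp0 : 0 < p := by linarith
  refine ⟨fun Z hZ => hZ.bddAbove hrich hσ hp, fun Z hZ Y hY => hZ.enorm_integral_le hrich hσ hp hY,
    fun Z₁ Z₂ h₁ h₂ h => h₁.ae_eq hσ hp0.le h₂ h, fun φ hadd hsmul hae ⟨C, hC⟩ => ?_⟩
  have hφ : IsBoundedFunctional P σ p φ |C| := by
    refine ⟨hadd, hsmul, hae, abs_nonneg C, fun Y hY => (hC Y hY).trans ?_⟩
    exact mul_le_mul_of_nonneg_right (le_abs_self C) ENNReal.toReal_nonneg
  exact hφ.exists_koetheDual hσ hp0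

end
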